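/- arXiv:1904.12955 — 2 statements merged into one kernel-verified Lean document; each statement's English description precedes it below -/
import Mathlib

section
/- For every vertex v ∈ ZMod (2n+1) with μ(v) = −1, there exists k ∈ {1, …, 2n} such that μ(v−k) = +1 and the open counterclockwise arc {v−k+1, …, v−1} is balanced. (Hence the B-partner of v is well defined as v−k for the least such k.) -/
open Finset

/-- The open counterclockwise arc `{v+1, …, v+(k-1)}` (indexed by `i = 1,…,k-1`) is
balanced: it contains as many elements where `μ = 1` as elements where `μ = -1`. -/
def ArcBalanced (n : ℕ) (μ : ZMod (2*n+1) → ℤ) (v : ZMod (2*n+1)) (k : ℕ) : Prop :=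
  ((Finset.Icc 1 (k-1)).filter fun i : ℕ => μ (v + (i : ZMod (2*n+1))) = 1).card =
  ((Finset.Icc 1 (k-1)).filter fun i : ℕ => μ (v + (i : ZMod (2*n+1))) = -1).card

/-- `k` is a valid cancellation length for an `A`-band at `v`:
`μ (v+k) = 1` and the open arc `{v+1, …, v+(k-1)}` is balanced. -/
def AGood (n : ℕ) (μ : ZMod (2*n+1) → ℤ) (v : ZMod (2*n+1)) (k : ℕ) : Prop :=
  μ (v + (k : ZMod (2*n+1))) = 1 ∧ ArcBalanced n μ v k

/-- `k` is a valid cancellation length for a `B`-band at `v`: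
`μ (v-k) = 1` and the open arc `{v-k+1, …, v-1}` is balanced. -/
def BGood (n : ℕ) (μ : ZMod (2*n+1) → ℤ) (v : ZMod (2*n+1)) (k : ℕ) : Prop :=
  μ (v - (k : ZMod (2*n+1))) = 1 ∧ ArcBalanced n μ (v - (k : ZMod (2*n+1))) k

/-- `w` is the `A`-partner of `v`: `w = v + k` for the least `k ∈ {1,…,2n}` with
`μ (v+k) = 1` and the open arc `{v+1,…,v+(k-1)}` balanced. -/
def IsAPartner (n : ℕ) (μ : ZMod (2*n+1) → ℤ) (v w : ZMod (2*n+1)) : Prop :=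
  ∃ k ∈ Finset.Icc 1 (2*n), AGood n μ v k ∧
    (∀ j ∈ Finset.Icc 1 (2*n), j < k → ¬ AGood n μ v j) ∧ w = v + (k : ZMod (2*n+1))

/-- `w` is the `B`-partner of `v`: `w = v - k` for the least `k ∈ {1,…,2n}` with
`μ (v-k) = 1` and the open arc `{v-k+1,…,v-1}` balanced. -/
def IsBPartner (n : ℕ) (μ : ZMod (2*n+1) → ℤ) (v w : ZMod (2*n+1)) : Prop :=
  ∃ k ∈ Finset.Icc 1 (2*n), BGood n μ v k ∧
    (∀ j ∈ Finset.Icc 1 (2*n), j < k → ¬ BGood n μ v j) ∧ w = v - (k : ZMod (2*n+1))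

/-- The auxiliary graph `G(μ)`: its edges are exactly the unordered pairs
`{v, A-partner of v}` and `{v, B-partner of v}` over all `v` with `μ v = -1`. -/
def G (n : ℕ) (μ : ZMod (2*n+1) → ℤ) : SimpleGraph (ZMod (2*n+1)) :=
  SimpleGraph.fromRel fun x y => μ x = -1 ∧ (IsAPartner n μ x y ∨ IsBPartner n μ x y)

noncomputable instance {n : ℕ} {μ : ZMod (2*n+1) → ℤ} {v : ZMod (2*n+1)} :
    Fintype ((G n μ).neighborSet v) := Fintype.ofFinite _

theorem sum_eq_card_filter_sub_card_filter {ι : Type*} (s : Finset ι) (f : ι → ℤ)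
    (hf : ∀ i, f i = 1 ∨ f i = -1) :
    ∑ i ∈ s, f i = ((s.filter fun i => f i = 1).card : ℤ) - (s.filter fun i => f i = -1).card := by
  rw [card_filter, card_filter]
  push_cast
  rw [← sum_sub_distrib]
  refine sum_congr rfl fun i _ => ?_
  rcases hf i with h | h <;> simp [h]

theorem ZMod.sum_range_sub_natCast {M : Type*} [AddCommMonoid M] (N : ℕ) [NeZero N]
    (f : ZMod N → M) (v : ZMod N) :
    ∑ i ∈ range N, f (v - (i : ZMod N)) = ∑ x, f x := by
  refine sum_nbij' (fun i => v - (i : ZMod N)) (fun x => (v - x).val) ?_ ?_ ?_ ?_ ?_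
  · simp
  · simp [ZMod.val_lt]
  · intro i hi
    simp [ZMod.val_cast_of_lt (mem_range.mp hi)]
  · simp
  · simp

theorem arcBalanced_iff_sum_eq_zero (n : ℕ) (μ : ZMod (2*n+1) → ℤ)
    (hval : ∀ v, μ v = 1 ∨ μ v = -1) (v : ZMod (2*n+1)) (m : ℕ) :
    ArcBalanced n μ (v - ((m + 1 : ℕ) : ZMod (2*n+1))) (m + 1) ↔
      ∑ i ∈ range m, μ (v - ((i + 1 : ℕ) : ZMod (2*n+1))) = 0 := by
  have hsum : ∑ i ∈ Icc 1 m, μ (v - ((m + 1 : ℕ) : ZMod (2*n+1)) + (i : ZMod (2*n+1))) =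
      ∑ i ∈ range m, μ (v - ((i + 1 : ℕ) : ZMod (2*n+1))) := by
    refine sum_nbij' (fun i => m - i) (fun i => m - i) ?_ ?_ ?_ ?_ ?_
    · intro i hi; simp at *; omega
    · intro i hi; simp at *; omega
    · intro i hi; simp at *; omega
    · intro i hi; simp at *; omega
    · intro i hi
      rw [mem_Icc] at hi
      congr 1
      push_cast [Nat.cast_sub hi.2]
      ring
  rw [← hsum, sum_eq_card_filter_sub_card_filter _ _ fun i => hval _, sub_eq_zero, Nat.cast_inj]
  rfl

theorem bPartner_exists (n : ℕ) (μ : ZMod (2*n+1) → ℤ)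
    (hn : 0 < n)
    (hval : ∀ v, μ v = 1 ∨ μ v = -1)
    (hplus : (Finset.univ.filter fun v : ZMod (2*n+1) => μ v = 1).card = n + 1)
    (hminus : (Finset.univ.filter fun v : ZMod (2*n+1) => μ v = -1).card = n) :
    ∀ v : ZMod (2*n+1), μ v = -1 →
      ∃ k ∈ Finset.Icc 1 (2*n), μ (v - (k : ZMod (2*n+1))) = 1 ∧
        ArcBalanced n μ (v - (k : ZMod (2*n+1))) k := by
  intro v hv
  set S : ℕ → ℤ := fun k => ∑ i ∈ range k, μ (v - ((i + 1 : ℕ) : ZMod (2*n+1))) with hS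
  have hend : 0 < S (2*n) := by
    have h := ZMod.sum_range_sub_natCast (2*n+1) μ v
    rw [sum_range_succ', sum_eq_card_filter_sub_card_filter univ μ hval, hplus, hminus,
      Nat.cast_zero, sub_zero, hv] at h
    push_cast at h
    simp only [hS]
    push_cast
    linarith
  have hex : ∃ k, 0 < S k := ⟨_, hend⟩
  obtain ⟨m, hm⟩ : ∃ m, Nat.find hex = m + 1 :=
    Nat.exists_eq_succ_of_ne_zero fun h => by
      have h0 := Nat.find_spec hex
      rw [h] at h0
      simp [hS] at h0
  have hpos : 0 < S (m + 1) := hm ▸ Nat.find_spec hex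
  have hnonpos : S m ≤ 0 := not_lt.mp (Nat.find_min hex (by omega))
  have hle : m + 1 ≤ 2*n := hm ▸ Nat.find_min' hex hend
  have hstep : S (m + 1) = S m + μ (v - ((m + 1 : ℕ) : ZMod (2*n+1))) := sum_range_succ _ _
  refine ⟨m + 1, mem_Icc.mpr ⟨by omega, hle⟩, ?_, ?_⟩
  · rcases hval (v - ((m + 1 : ℕ) : ZMod (2*n+1))) with h | h <;> omega
  · rw [arcBalanced_iff_sum_eq_zero n μ hval]
    change S m = 0
    rcases hval (v - ((m + 1 : ℕ) : ZMod (2*n+1))) with h | h <;> omega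
end

section
/- If v and v′ are distinct vertices of ZMod (2n+1) with μ(v) = μ(v′) = −1, then the B-partner of v and the B-partner of v′ are distinct; that is, the map sending each vertex with μ = −1 to its B-partner is injective. -/
open Finset

/-- The sum of `μ` over the arc `{v+1, …, v+m}`. -/
def arcSum (n : ℕ) (μ : ZMod (2*n+1) → ℤ) (v : ZMod (2*n+1)) (m : ℕ) : ℤ :=
  ∑ i ∈ Finset.range m, μ (v + ((i + 1 : ℕ) : ZMod (2*n+1)))

theorem arcSum_succ (n : ℕ) (μ : ZMod (2*n+1) → ℤ) (v : ZMod (2*n+1)) (m : ℕ) :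
    arcSum n μ v (m + 1) = arcSum n μ v m + μ (v + ((m + 1 : ℕ) : ZMod (2*n+1))) :=
  Finset.sum_range_succ _ _

theorem arcSum_add (n : ℕ) (μ : ZMod (2*n+1) → ℤ) (v : ZMod (2*n+1)) (p m : ℕ) :
    arcSum n μ v (p + m) = arcSum n μ v p + arcSum n μ (v + (p : ZMod (2*n+1))) m := by
  simp only [arcSum, Finset.sum_range_add, add_assoc, Nat.cast_add]

theorem arcBalanced_succ_iff {n : ℕ} {μ : ZMod (2*n+1) → ℤ} (hval : ∀ v, μ v = 1 ∨ μ v = -1)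
    (v : ZMod (2*n+1)) (m : ℕ) : ArcBalanced n μ v (m + 1) ↔ arcSum n μ v m = 0 := by
  have hsum : arcSum n μ v m = ∑ i ∈ Finset.Icc 1 m, μ (v + (i : ZMod (2*n+1))) := by
    rw [arcSum, Finset.range_eq_Ico,
      Finset.sum_Ico_add' (fun i : ℕ => μ (v + (i : ZMod (2*n+1)))) 0 m 1]
    rfl
  have hdiff : arcSum n μ v m =
      ((Finset.Icc 1 m).filter fun i : ℕ => μ (v + (i : ZMod (2*n+1))) = 1).card -
      ((Finset.Icc 1 m).filter fun i : ℕ => μ (v + (i : ZMod (2*n+1))) = -1).card := by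
    rw [hsum, Finset.card_filter, Finset.card_filter]
    push_cast
    rw [← Finset.sum_sub_distrib]
    refine Finset.sum_congr rfl fun i _ => ?_
    rcases hval (v + (i : ZMod (2*n+1))) with h | h <;> simp [h]
  rw [hdiff, sub_eq_zero, Nat.cast_inj]
  rfl

/-- A sequence of integers with steps at most `1` that goes from a negative value at `a` to a
nonnegative value at `b` passes from `-1` to `0` in between. -/
theorem exists_step_to_zero {f : ℕ → ℤ} (hf : ∀ i, f (i + 1) ≤ f i + 1) {a b : ℕ} (hab : a ≤ b)
    (ha : f a < 0) (hb : 0 ≤ f b) : ∃ p, a ≤ p ∧ p < b ∧ f p = -1 ∧ f (p + 1) = 0 := by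
  induction b, hab using Nat.le_induction with
  | base => omega
  | succ b hab ih =>
    by_cases h : 0 ≤ f b
    · obtain ⟨p, hap, hpb, hp⟩ := ih h
      exact ⟨p, hap, by omega, hp⟩
    · have := hf b
      exact ⟨b, hab, by omega, by omega, by omega⟩

/-- If the arcs from `w` to two vertices with `μ = -1` are both balanced, then the farther vertex
has a valid cancellation length shorter than its distance from `w`. -/
theorem exists_bGood_lt {n : ℕ} {μ : ZMod (2*n+1) → ℤ} (hval : ∀ v, μ v = 1 ∨ μ v = -1)
    {w : ZMod (2*n+1)} {k l : ℕ} (hk : 0 < k) (hkl : k < l)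
    (hμ : μ (w + (k : ZMod (2*n+1))) = -1)
    (hbk : ArcBalanced n μ w k) (hbl : ArcBalanced n μ w l) :
    ∃ j, 1 ≤ j ∧ j < l ∧ BGood n μ (w + (l : ZMod (2*n+1))) j := by
  obtain ⟨k, rfl⟩ := Nat.exists_eq_succ_of_ne_zero hk.ne'
  obtain ⟨l, rfl⟩ := Nat.exists_eq_succ_of_ne_zero (hk.trans hkl).ne'
  rw [Nat.succ_eq_add_one] at *
  rw [arcBalanced_succ_iff hval] at hbk hbl
  have hstep (i : ℕ) : arcSum n μ w (i + 1) ≤ arcSum n μ w i + 1 := by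
    rw [arcSum_succ]
    rcases hval (w + ((i + 1 : ℕ) : ZMod (2*n+1))) with h | h <;> omega
  have hneg : arcSum n μ w (k + 1) < 0 := by
    rw [arcSum_succ]
    omega
  obtain ⟨p, hkp, hpl, hp, hp'⟩ := exists_step_to_zero hstep (by omega : k + 1 ≤ l) hneg hbl.ge
  obtain ⟨m, rfl⟩ := Nat.exists_eq_add_of_le (Nat.succ_le_of_lt hpl)
  rw [Nat.succ_eq_add_one] at *
  have hsub : w + ((p + 1 + m + 1 : ℕ) : ZMod (2*n+1)) - ((m + 1 : ℕ) : ZMod (2*n+1)) =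
      w + ((p + 1 : ℕ) : ZMod (2*n+1)) := by
    push_cast
    ring
  refine ⟨m + 1, by omega, by omega, ?_, ?_⟩
  · rw [hsub]
    have := arcSum_succ n μ w p
    omega
  · rw [hsub, arcBalanced_succ_iff hval]
    have := arcSum_add n μ w (p + 1) m
    omega

theorem bPartner_injective (n : ℕ) (μ : ZMod (2*n+1) → ℤ)
    (hn : 0 < n)
    (hval : ∀ v, μ v = 1 ∨ μ v = -1)
    (hplus : (Finset.univ.filter fun v : ZMod (2*n+1) => μ v = 1).card = n + 1)
    (hminus : (Finset.univ.filter fun v : ZMod (2*n+1) => μ v = -1).card = n) :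
    ∀ v v' w w' : ZMod (2*n+1), μ v = -1 → μ v' = -1 → v ≠ v' →
      IsBPartner n μ v w → IsBPartner n μ v' w' → w ≠ w'  := by
  intro v v' w w' hv hv' hne
  rintro ⟨k, hk, hgood, hmin, rfl⟩ ⟨l, hl, hgood', hmin', rfl⟩ heq
  wlog hkl : k < l generalizing v v' k l
  · refine this v' v hv' hv hne.symm l hl hgood' hmin' k hk hgood hmin heq.symm ?_
    refine lt_of_le_of_ne (not_lt.mp hkl) fun h => hne ?_
    subst h
    exact sub_left_injective heq
  rw [Finset.mem_Icc] at hk hl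
  have hbl := hgood'.2
  rw [← heq] at hbl
  obtain ⟨j, hj, hjl, hjgood⟩ :=
    exists_bGood_lt hval (by omega) hkl (by rwa [sub_add_cancel]) hgood.2 hbl
  rw [heq, sub_add_cancel] at hjgood
  exact hmin' j (Finset.mem_Icc.mpr ⟨hj, by omega⟩) hjl hjgood
end
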